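/- Let U₁ and U₂ be 2^(N-1) × 2^(N-1) unitary matrices and suppose U₁ ⊕ U₂ ∈ CH_k on N qubits for some k ≥ 2. Then for every integer m ≥ 0 with k - m - 1 ≥ 1, the gate ((U₁U₂†)^(2^m) ⊕ (U₂U₁†)^(2^m)) · (X ⊗ I) lies in CH_{k-m-1}, where X is the single-qubit Pauli X and I is the 2^(N-1) × 2^(N-1) identity. -/

import Mathlib

open Matrix

noncomputable section

/-- `QMat n` : operators on `n` qubits, identified with `2^n × 2^n` complex matrices
(indexed by bit strings `Fin n → Fin 2`). -/
abbrev QMat (n : ℕ) := Matrix (Fin n → Fin 2) (Fin n → Fin 2) ℂ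

/-- The single-qubit Pauli `X` matrix. -/
def σX : Matrix (Fin 2) (Fin 2) ℂ := !![0, 1; 1, 0]

/-- The single-qubit Pauli `Y` matrix. -/
def σY : Matrix (Fin 2) (Fin 2) ℂ := !![0, -Complex.I; Complex.I, 0]

/-- The single-qubit Pauli `Z` matrix. -/
def σZ : Matrix (Fin 2) (Fin 2) ℂ := !![1, 0; 0, -1]

/-- The set `{I, X, Y, Z}` of single-qubit Pauli matrices. -/
def pauliSet : Set (Matrix (Fin 2) (Fin 2) ℂ) := {1, σX, σY, σZ}

/-- The tensor (Kronecker) product `σ 0 ⊗ ⋯ ⊗ σ (n-1)` of single-qubit matrices. -/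
def tensorStr {n : ℕ} (σ : Fin n → Matrix (Fin 2) (Fin 2) ℂ) : QMat n :=
  fun f g => ∏ i, σ i (f i) (g i)

/-- The `n`-qubit Pauli group `P_n`: all `c • (σ₁ ⊗ ⋯ ⊗ σₙ)` with
`σᵢ ∈ {I, X, Y, Z}` and `c ∈ {1, -1, i, -i}`. -/
def PauliGroup (n : ℕ) : Set (QMat n) :=
  {P | ∃ c ∈ ({1, -1, Complex.I, -Complex.I} : Set ℂ),
    ∃ σ : Fin n → Matrix (Fin 2) (Fin 2) ℂ, (∀ i, σ i ∈ pauliSet) ∧ P = c • tensorStr σ}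

/-- Kronecker product `M ⊗ A` of a single-qubit matrix `M` with an `n`-qubit matrix `A`
(the single qubit is the first/topmost factor). -/
def kron {n : ℕ} (M : Matrix (Fin 2) (Fin 2) ℂ) (A : QMat n) : QMat (n + 1) :=
  fun f g => M (f 0) (g 0) * A (fun i => f i.succ) (fun i => g i.succ)

/-- The block-diagonal direct sum `A ⊕ B = |0⟩⟨0| ⊗ A + |1⟩⟨1| ⊗ B`. -/
def dSum {n : ℕ} (A B : QMat n) : QMat (n + 1) :=
  kron !![1, 0; 0, 0] A + kron !![0, 0; 0, 1] B

/-- The Clifford Hierarchy on `n` qubits: `CH n 1 = P_n`, and for `k ≥ 2`,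
`CH n k` consists of the unitaries `U` with `U P U† ∈ CH n (k-1)` for all `P ∈ P_n`.
(The index `0` is unused and set to `∅`.) -/
def CH (n : ℕ) : ℕ → Set (QMat n)
  | 0 => ∅
  | 1 => PauliGroup n
  | (k + 2) => {U | U ∈ unitary (QMat n) ∧ ∀ P ∈ PauliGroup n, U * P * star U ∈ CH n (k + 1)}

theorem kron_mul {n : ℕ} (M N : Matrix (Fin 2) (Fin 2) ℂ) (A B : QMat n) :
    kron M A * kron N B = kron (M * N) (A * B) := by
  ext f g
  simp only [Matrix.mul_apply, kron]
  rw [← (Fin.consEquiv (fun _ : Fin (n + 1) => Fin 2)).sum_comp, Fintype.sum_prod_type,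
    Finset.sum_mul_sum]
  refine Finset.sum_congr rfl fun i _ => Finset.sum_congr rfl fun j _ => ?_
  simp [Fin.consEquiv]
  ring

theorem kron_star {n : ℕ} (M : Matrix (Fin 2) (Fin 2) ℂ) (A : QMat n) :
    star (kron M A) = kron (star M) (star A) := by
  ext f g
  simp [kron, Matrix.star_apply]

theorem kron_zero_left {n : ℕ} (A : QMat n) : kron 0 A = 0 := by
  ext f g
  simp [kron]

theorem dSum_mul {n : ℕ} (A B C D : QMat n) :
    dSum A B * dSum C D = dSum (A * C) (B * D) := by
  have e1 : (!![1, 0; 0, 0] : Matrix (Fin 2) (Fin 2) ℂ) * !![0, 0; 0, 1] = 0 := by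
    ext i j; fin_cases i <;> fin_cases j <;> simp
  have e2 : (!![0, 0; 0, 1] : Matrix (Fin 2) (Fin 2) ℂ) * !![1, 0; 0, 0] = 0 := by
    ext i j; fin_cases i <;> fin_cases j <;> simp
  have e3 : (!![1, 0; 0, 0] : Matrix (Fin 2) (Fin 2) ℂ) * !![1, 0; 0, 0] = !![1, 0; 0, 0] := by
    ext i j; fin_cases i <;> fin_cases j <;> simp
  have e4 : (!![0, 0; 0, 1] : Matrix (Fin 2) (Fin 2) ℂ) * !![0, 0; 0, 1] = !![0, 0; 0, 1] := by
    ext i j; fin_cases i <;> fin_cases j <;> simp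
  simp only [dSum, mul_add, add_mul, kron_mul, e1, e2, e3, e4, kron_zero_left, add_zero, zero_add]

theorem dSum_star {n : ℕ} (A B : QMat n) :
    star (dSum A B) = dSum (star A) (star B) := by
  have e1 : star (!![1, 0; 0, 0] : Matrix (Fin 2) (Fin 2) ℂ) = !![1, 0; 0, 0] := by
    ext i j; fin_cases i <;> fin_cases j <;> simp [Matrix.star_apply]
  have e2 : star (!![0, 0; 0, 1] : Matrix (Fin 2) (Fin 2) ℂ) = !![0, 0; 0, 1] := by
    ext i j; fin_cases i <;> fin_cases j <;> simp [Matrix.star_apply]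
  simp only [dSum, star_add, kron_star, e1, e2]

theorem X_dSum {n : ℕ} (A B : QMat n) :
    kron σX 1 * dSum A B = dSum B A * kron σX 1 := by
  have e1 : σX * !![1, 0; 0, 0] = !![0, 0; 0, 1] * σX := by
    ext i j; fin_cases i <;> fin_cases j <;> simp [σX]
  have e2 : σX * !![0, 0; 0, 1] = !![1, 0; 0, 0] * σX := by
    ext i j; fin_cases i <;> fin_cases j <;> simp [σX]
  simp only [dSum, mul_add, add_mul, kron_mul, e1, e2, one_mul, mul_one]
  exact add_comm _ _

theorem X_star {n : ℕ} : star (kron σX (1 : QMat n)) = kron σX 1 := by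
  have e : star σX = σX := by
    ext i j; fin_cases i <;> fin_cases j <;> simp [σX, Matrix.star_apply]
  rw [kron_star, e, star_one]

theorem X_sq {n : ℕ} : kron σX (1 : QMat n) * kron σX 1 = 1 := by
  have e : σX * σX = 1 := by
    ext i j; fin_cases i <;> fin_cases j <;> simp [σX]
  rw [kron_mul, e, one_mul]
  ext f g
  simp only [kron, Matrix.one_apply, funext_iff, Fin.forall_fin_succ]
  by_cases h : f 0 = g 0 <;> simp [h]

theorem X_pauli {n : ℕ} : kron σX (1 : QMat n) ∈ PauliGroup (n + 1) := by
  refine ⟨1, by simp, Fin.cons σX (fun _ => 1), ?_, ?_⟩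
  · intro i
    refine Fin.cases ?_ (fun i => ?_) i <;> simp [pauliSet]
  · ext f g
    simp only [kron, tensorStr, Matrix.smul_apply, one_smul, Fin.prod_univ_succ, Fin.cons_zero,
      Fin.cons_succ, Matrix.one_apply, Finset.prod_ite_zero, funext_iff]
    simp

theorem CH_conj {n j : ℕ} {U : QMat (n + 1)} (h : U ∈ CH (n + 1) (j + 2)) :
    U * kron σX 1 * star U ∈ CH (n + 1) (j + 1) :=
  h.2 _ X_pauli

/-- If `U₁ ⊕ U₂ ∈ CH_k` on `N = n + 1` qubits for some `k ≥ 2`, then for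
every integer `m ≥ 0` with `k - m - 1 ≥ 1` the gate
`((U₁U₂†)^(2^m) ⊕ (U₂U₁†)^(2^m)) · (X ⊗ I)` lies in `CH_{k-m-1}`. -/
theorem stmt11 (n k : ℕ) (hk : 2 ≤ k) (U₁ U₂ : QMat n)
    (h₁ : U₁ ∈ unitary (QMat n)) (h₂ : U₂ ∈ unitary (QMat n))
    (hU : dSum U₁ U₂ ∈ CH (n + 1) k) (m : ℕ) (hm : 1 ≤ k - m - 1) :
    dSum ((U₁ * U₂ᴴ) ^ 2 ^ m) ((U₂ * U₁ᴴ) ^ 2 ^ m) * kron σX 1 ∈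
      CH (n + 1) (k - m - 1) := by
  induction m with
  | zero =>
    obtain ⟨j, rfl⟩ : ∃ j, k = j + 2 := ⟨k - 2, by omega⟩
    have h := CH_conj hU
    rw [dSum_star, mul_assoc, X_dSum, ← mul_assoc, dSum_mul] at h
    simpa [Matrix.star_eq_conjTranspose] using h
  | succ m ih =>
    have ih := ih (by omega)
    obtain ⟨j, hj⟩ : ∃ j, k - m - 1 = j + 2 := ⟨k - m - 3, by omega⟩
    rw [hj] at ih
    have h := CH_conj ih
    have e : k - (m + 1) - 1 = j + 1 := by omega
    have s1 : star ((U₁ * U₂ᴴ) ^ 2 ^ m) = (U₂ * U₁ᴴ) ^ 2 ^ m := by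
      simp [star_pow, ← Matrix.star_eq_conjTranspose]
    have s2 : star ((U₂ * U₁ᴴ) ^ 2 ^ m) = (U₁ * U₂ᴴ) ^ 2 ^ m := by
      simp [star_pow, ← Matrix.star_eq_conjTranspose]
    rw [mul_assoc (dSum _ _), X_sq, mul_one, star_mul, X_star, dSum_star, X_dSum, s1, s2,
      ← mul_assoc, dSum_mul, ← pow_add, ← pow_add] at h
    rw [e, pow_succ 2 m, mul_two]
    exact h
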